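/- Let A be an atomic weakly associative relation algebra. Then every labelling system (U,T) for A can be extended to a complete labelling system, i.e., there is a labelling system (U',T') with U ⊆ U', T ⊆ T', and (U',T') has no flaws. -/

import Mathlib

universe u v

/-- A weakly associative relation algebra: a Boolean algebra equipped with
relative multiplication `comp`, converse `conv`, and identity `one'`
satisfying the WA axioms. -/
structure WA (A : Type*) [BooleanAlgebra A] where
  comp : A → A → A
  conv : A → A
  one' : A
  wassoc : ∀ x : A, comp (comp (x ⊓ one') ⊤) ⊤ = comp (x ⊓ one') ⊤
  rdist : ∀ x y z : A, comp (x ⊔ y) z = comp x z ⊔ comp y z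
  comp_one' : ∀ x : A, comp x one' = x
  conv_conv : ∀ x : A, conv (conv x) = x
  conv_sup : ∀ x y : A, conv (x ⊔ y) = conv x ⊔ conv y
  conv_comp : ∀ x y : A, conv (comp x y) = comp (conv y) (conv x)
  tarski : ∀ x y : A, comp (conv x) (comp x y)ᶜ ≤ yᶜ

/-- A labelling system for a WA `W`: a set of labelled edges
`T ⊆ U × At(A) × U` satisfying conditions (i)--(v). -/
structure LabSys {A : Type*} [BooleanAlgebra A] (W : WA A) (U : Type*) where
  T : Set (U × A × U)
  mem_atom : ∀ ⦃u : U⦄ ⦃a : A⦄ ⦃v : U⦄, (u, a, v) ∈ T → IsAtom a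
  functional : ∀ ⦃u : U⦄ ⦃a b : A⦄ ⦃v : U⦄, (u, a, v) ∈ T → (u, b, v) ∈ T → a = b
  ident_exists : ∀ a : A, IsAtom a → a ≤ W.one' → ∃ u : U, (u, a, u) ∈ T
  ident_iff : ∀ u v : U, u = v ↔ ∃ a : A, IsAtom a ∧ a ≤ W.one' ∧ (u, a, v) ∈ T
  conv_mem : ∀ ⦃u : U⦄ ⦃a : A⦄ ⦃v : U⦄, (u, a, v) ∈ T → (v, W.conv a, u) ∈ T
  triangle : ∀ ⦃u : U⦄ ⦃a : A⦄ ⦃v : U⦄ ⦃b : A⦄ ⦃w : U⦄ ⦃c : A⦄,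
    (u, a, v) ∈ T → (v, b, w) ∈ T → (u, c, w) ∈ T → c ≤ W.comp a b

/-- `(u,a,v,b,c)` is a flaw in the labelling system `L`. -/
def Flaw {A : Type*} [BooleanAlgebra A] (W : WA A) {U : Type*} (L : LabSys W U)
    (u : U) (a : A) (v : U) (b c : A) : Prop :=
  IsAtom a ∧ IsAtom b ∧ IsAtom c ∧ (u, a, v) ∈ L.T ∧ a ≤ W.comp b c ∧
    ∀ w : U, (u, b, w) ∉ L.T ∨ (w, c, v) ∉ L.T

namespace WA

section Algebra

variable {A : Type*} [BooleanAlgebra A] (W : WA A)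

theorem conv_mono {x y : A} (h : x ≤ y) : W.conv x ≤ W.conv y := by
  rw [← sup_eq_right] at h ⊢
  rw [← W.conv_sup, h]

theorem conv_le_iff {x y : A} : W.conv x ≤ y ↔ x ≤ W.conv y := by
  constructor
  · intro h
    simpa [W.conv_conv] using W.conv_mono h
  · intro h
    simpa [W.conv_conv] using W.conv_mono h

theorem comp_mono_left {x y : A} (z : A) (h : x ≤ y) : W.comp x z ≤ W.comp y z := by
  rw [← sup_eq_right] at h ⊢
  rw [← W.rdist, h]

theorem comp_mono_right (x : A) {y z : A} (h : y ≤ z) : W.comp x y ≤ W.comp x z := by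
  have := W.conv_mono (W.comp_mono_left (W.conv x) (W.conv_mono h))
  simpa [W.conv_comp, W.conv_conv] using this

theorem comp_sup (x y z : A) : W.comp x (y ⊔ z) = W.comp x y ⊔ W.comp x z := by
  have := congrArg W.conv (W.rdist (W.conv y) (W.conv z) (W.conv x))
  simpa [W.conv_comp, W.conv_conv, W.conv_sup] using this

theorem conv_one' : W.conv W.one' = W.one' := by
  have h := congrArg W.conv (W.comp_one' (W.conv W.one'))
  rw [W.conv_comp, W.conv_conv, W.comp_one'] at h
  exact h

theorem one'_comp (x : A) : W.comp W.one' x = x := by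
  have h := congrArg W.conv (W.comp_one' (W.conv x))
  rwa [W.conv_comp, W.conv_conv, W.conv_one'] at h

theorem conv_le_one'_iff {x : A} : W.conv x ≤ W.one' ↔ x ≤ W.one' := by
  rw [W.conv_le_iff, W.conv_one']

theorem isAtom_conv {a : A} (ha : IsAtom a) : IsAtom (W.conv a) := by
  have hbot : W.conv ⊥ = ⊥ := le_bot_iff.mp (W.conv_le_iff.mpr bot_le)
  rw [isAtom_iff_le_of_ge] at ha ⊢
  refine ⟨fun h => ha.1 ?_, fun b hb hle => ?_⟩
  · rw [← W.conv_conv a, h, hbot]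
  · rw [W.conv_le_iff]
    refine ha.2 _ (fun h => hb ?_) (W.conv_le_iff.mpr hle)
    rw [← W.conv_conv b, h, hbot]

theorem conv_le_comp {a b c : A} (h : a ≤ W.comp b c) :
    W.conv a ≤ W.comp (W.conv c) (W.conv b) := by
  rw [← W.conv_comp]
  exact W.conv_mono h

theorem cycle_right {a b c : A} (ha : IsAtom a) (hc : IsAtom c) (h : a ≤ W.comp b c) :
    c ≤ W.comp (W.conv b) a := by
  by_contra hn
  have h1 : c ≤ (W.comp (W.conv b) a)ᶜ :=
    (hc.not_le_iff_disjoint.mp hn).le_compl_right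
  have h2 := W.tarski (W.conv b) a
  rw [W.conv_conv] at h2
  have h3 : a ≤ aᶜ := h.trans ((W.comp_mono_right b h1).trans h2)
  exact ha.1 (le_compl_self.mp h3)

theorem cycle_left {a b c : A} (ha : IsAtom a) (hb : IsAtom b) (h : a ≤ W.comp b c) :
    b ≤ W.comp a (W.conv c) := by
  have := W.cycle_right (W.isAtom_conv ha) (W.isAtom_conv hb) (W.conv_le_comp h)
  simpa [W.conv_comp, W.conv_conv] using W.conv_mono this

theorem exists_domain (hatomic : ∀ x : A, x ≠ ⊥ → ∃ a : A, IsAtom a ∧ a ≤ x)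
    {b : A} (hb : IsAtom b) :
    ∃ e, IsAtom e ∧ e ≤ W.one' ∧ e ≤ W.comp b (W.conv b) := by
  obtain ⟨e, he, hle⟩ := hatomic (W.one' ⊓ W.comp b (W.conv b)) (by
    intro h
    have h1 : W.one' ≤ (W.comp b (W.conv b))ᶜ := (disjoint_iff.mpr h).le_compl_right
    have h2 := (W.comp_mono_right (W.conv b) h1).trans (W.tarski b (W.conv b))
    rw [W.comp_one'] at h2
    exact (W.isAtom_conv hb).1 (le_compl_self.mp h2))
  exact ⟨e, he, hle.trans inf_le_left, hle.trans inf_le_right⟩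

theorem le_comp_self_of_le_comp {e b x : A} (he : e ≤ W.one') (h : b ≤ W.comp e x) :
    b ≤ W.comp e b := by
  have h1 : b ≤ W.comp e (b ⊔ bᶜ) := by
    rw [sup_compl_eq_top]
    exact h.trans (W.comp_mono_right e le_top)
  have h2 : W.comp e bᶜ ≤ bᶜ := by
    simpa [W.one'_comp] using W.comp_mono_left bᶜ he
  rw [W.comp_sup] at h1
  have h3 := le_inf (h1.trans (sup_le_sup_left h2 _)) le_rfl
  rw [inf_sup_right, compl_inf_eq_bot, sup_bot_eq] at h3
  exact h3.trans inf_le_left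

theorem domain_of_le_comp {e a b c : A} (he : e ≤ W.one') (hb : b ≤ W.comp e b)
    (h : a ≤ W.comp b c) : a ≤ W.comp e a := by
  have hw := W.wassoc e
  rw [inf_eq_left.mpr he] at hw
  refine W.le_comp_self_of_le_comp (x := ⊤) he ?_
  rw [← hw]
  exact h.trans ((W.comp_mono_right b le_top).trans
    (W.comp_mono_left ⊤ (hb.trans (W.comp_mono_right e le_top))))

theorem domain_unique {e f b : A} (he : IsAtom e) (hf : IsAtom f) (hb : IsAtom b)
    (he1 : e ≤ W.one') (hf1 : f ≤ W.one') (heb : b ≤ W.comp e b) (hfb : b ≤ W.comp f b) :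
    e = f := by
  have h1 := W.domain_of_le_comp hf1 hfb (W.cycle_left hb he heb)
  have h2 := W.comp_mono_right f he1
  rw [W.comp_one'] at h2
  exact (hf.le_iff_eq he.1).mp (h1.trans h2)

theorem subidentity_le_comp_self (hatomic : ∀ x : A, x ≠ ⊥ → ∃ a : A, IsAtom a ∧ a ≤ x)
    {e : A} (he : IsAtom e) (he1 : e ≤ W.one') : e ≤ W.comp e e ∧ W.conv e = e := by
  obtain ⟨f, hf, hf1, hle⟩ := W.exists_domain hatomic he
  have h1 : f ≤ e := by
    simpa [W.comp_one'] using
      hle.trans (W.comp_mono_right e (W.conv_le_one'_iff.mpr he1))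
  have h2 : f ≤ W.conv e := by
    simpa [W.one'_comp] using hle.trans (W.comp_mono_left (W.conv e) he1)
  obtain rfl := (he.le_iff_eq hf.1).mp h1
  have h3 := ((W.isAtom_conv hf).le_iff_eq hf.1).mp h2
  exact ⟨by rwa [← h3] at hle, h3.symm⟩

end Algebra

end WA

namespace LabSys

/-- Points of the free completion of a labelling system: the given points, and formal
witnesses `wit p a q b c` splitting an edge `(p, a, q)` into `(p, b, _)` and `(_, c, q)`. -/
inductive Point (A : Type u) (U : Type v) : Type (max u v)
  | base : U → Point A U
  | wit : Point A U → A → Point A U → A → A → Point A U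

namespace Point

variable {A : Type u} {U : Type v}

/-- The nesting depth of witnesses in a point. -/
def depth : Point A U → ℕ
  | base _ => 0
  | wit p _ q _ _ => p.depth + q.depth + 1

end Point

variable {A : Type u} [BooleanAlgebra A] {W : WA A} {U : Type v} (L : LabSys W U)

open Point

/-- The edges `b`, `c` may be used to split an edge labelled `a` by a new point. -/
structure Splits (W : WA A) (a b c : A) : Prop where
  left_atom : IsAtom b
  right_atom : IsAtom c
  le : a ≤ W.comp b c
  left_not_le : ¬ b ≤ W.one'
  right_not_le : ¬ c ≤ W.one'

/-- The labelled edges of the free completion of `L`. -/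
inductive Edge : Point A U → A → Point A U → Prop
  | base {u a v} : (u, a, v) ∈ L.T → Edge (base u) a (base v)
  | loop {p a q b c e} : Edge p a q → Splits W a b c → IsAtom e → e ≤ W.one' →
      e ≤ W.comp (W.conv b) b → Edge (wit p a q b c) e (wit p a q b c)
  | left {p a q b c} : Edge p a q → Splits W a b c → Edge p b (wit p a q b c)
  | left_conv {p a q b c} : Edge p a q → Splits W a b c →
      Edge (wit p a q b c) (W.conv b) p
  | right {p a q b c} : Edge p a q → Splits W a b c → Edge (wit p a q b c) c q
  | right_conv {p a q b c} : Edge p a q → Splits W a b c →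
      Edge q (W.conv c) (wit p a q b c)

/-- The point `w` is a witness splitting an edge one of whose endpoints is `x`, and `s`
labels the edge from `x` to `w`. -/
def Child (x : Point A U) (s : A) (w : Point A U) : Prop :=
  ∃ p a q b c, w = wit p a q b c ∧ L.Edge p a q ∧ Splits W a b c ∧
    ((x = p ∧ s = b) ∨ (x = q ∧ s = W.conv c))

variable {L}

theorem Child.depth_lt {x w : Point A U} {s : A} (h : L.Child x s w) : x.depth < w.depth := by
  obtain ⟨p, a, q, b, c, rfl, -, -, ⟨rfl, -⟩ | ⟨rfl, -⟩⟩ := h <;>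
    simp only [Point.depth] <;> omega

namespace Edge

theorem isAtom {x y : Point A U} {s : A} (h : L.Edge x s y) : IsAtom s := by
  cases h with
  | base h => exact L.mem_atom h
  | loop _ _ h => exact h
  | left _ h => exact h.left_atom
  | left_conv _ h => exact W.isAtom_conv h.left_atom
  | right _ h => exact h.right_atom
  | right_conv _ h => exact W.isAtom_conv h.right_atom

theorem conv (hatomic : ∀ x : A, x ≠ ⊥ → ∃ a : A, IsAtom a ∧ a ≤ x)
    {x y : Point A U} {s : A} (h : L.Edge x s y) : L.Edge y (W.conv s) x := by
  cases h with
  | base h => exact .base (L.conv_mem h)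
  | loop h hs he he1 hle =>
    rw [(W.subidentity_le_comp_self hatomic he he1).2]
    exact .loop h hs he he1 hle
  | left h hs => exact .left_conv h hs
  | left_conv h hs =>
    rw [W.conv_conv]
    exact .left h hs
  | right h hs => exact .right_conv h hs
  | right_conv h hs =>
    rw [W.conv_conv]
    exact .right h hs

theorem classify {x y : Point A U} {s : A} (h : L.Edge x s y) :
    (∃ u v, x = Point.base u ∧ y = Point.base v ∧ (u, s, v) ∈ L.T) ∨
    (x = y ∧ s ≤ W.one' ∧ ∃ p a q b c, x = wit p a q b c ∧ IsAtom b ∧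
      s ≤ W.comp (W.conv b) b) ∨
    L.Child x s y ∨ L.Child y (W.conv s) x := by
  cases h with
  | base h => exact .inl ⟨_, _, rfl, rfl, h⟩
  | loop h hs _ he1 hle =>
    exact .inr (.inl ⟨rfl, he1, _, _, _, _, _, rfl, hs.left_atom, hle⟩)
  | left h hs => exact .inr (.inr (.inl ⟨_, _, _, _, _, rfl, h, hs, .inl ⟨rfl, rfl⟩⟩))
  | left_conv h hs =>
    exact .inr (.inr (.inr ⟨_, _, _, _, _, rfl, h, hs, .inl ⟨rfl, W.conv_conv _⟩⟩))
  | right h hs => exact .inr (.inr (.inr ⟨_, _, _, _, _, rfl, h, hs, .inr ⟨rfl, rfl⟩⟩))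
  | right_conv h hs =>
    exact .inr (.inr (.inl ⟨_, _, _, _, _, rfl, h, hs, .inr ⟨rfl, rfl⟩⟩))

theorem le_one'_of_self {x : Point A U} {s : A} (h : L.Edge x s x) : s ≤ W.one' := by
  rcases h.classify with ⟨u, v, hu, hv, hT⟩ | ⟨-, h, -⟩ | h | h
  · obtain rfl : u = v := by simpa using hu.symm.trans hv
    obtain ⟨a, -, ha, haT⟩ := (L.ident_iff u u).mp rfl
    rwa [L.functional hT haT]
  · exact h
  · exact absurd h.depth_lt (lt_irrefl _)
  · exact absurd h.depth_lt (lt_irrefl _)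

theorem eq_of_le_one' {x y : Point A U} {s : A} (h : L.Edge x s y) (hs : s ≤ W.one') :
    x = y := by
  cases h with
  | base h => rw [(L.ident_iff _ _).mpr ⟨_, L.mem_atom h, hs, h⟩]
  | loop => rfl
  | left _ h => exact absurd hs h.left_not_le
  | left_conv _ h => exact absurd (W.conv_le_one'_iff.mp hs) h.left_not_le
  | right _ h => exact absurd hs h.right_not_le
  | right_conv _ h => exact absurd (W.conv_le_one'_iff.mp hs) h.right_not_le

theorem domain_wit {p q : Point A U} {a b c e : A}
    (h : L.Edge (wit p a q b c) e (wit p a q b c)) :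
    W.conv b ≤ W.comp e (W.conv b) := by
  rcases h.classify with ⟨u, v, hu, -⟩ | ⟨-, he1, p', a', q', b', c', heq, hb, hle⟩ | h' | h'
  · cases hu
  · cases heq
    exact W.cycle_left h.isAtom (W.isAtom_conv hb) hle
  · exact absurd h'.depth_lt (lt_irrefl _)
  · exact absurd h'.depth_lt (lt_irrefl _)

theorem domain_and_range (hatomic : ∀ x : A, x ≠ ⊥ → ∃ a : A, IsAtom a ∧ a ≤ x)
    {x y : Point A U} {s : A} (h : L.Edge x s y) :
    (∀ e, L.Edge x e x → s ≤ W.comp e s) ∧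
    ∀ e, L.Edge y e y → W.conv s ≤ W.comp e (W.conv s) := by
  have base_case : ∀ {u a e}, L.Edge (Point.base u) e (Point.base u) →
      ∀ {v}, (u, a, v) ∈ L.T → a ≤ W.comp e a := by
    intro u a e he v ha
    cases he with
    | base he => exact L.triangle he ha ha
  have wit_right : ∀ {p q : Point A U} {a b c e : A}, L.Edge p a q → Splits W a b c →
      L.Edge (wit p a q b c) e (wit p a q b c) → c ≤ W.comp e c := fun hpq hs he =>
    W.domain_of_le_comp he.le_one'_of_self he.domain_wit
      (W.cycle_right hpq.isAtom hs.right_atom hs.le)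
  induction h with
  | base h => exact ⟨fun e he => base_case he h, fun e he => base_case he (L.conv_mem h)⟩
  | @loop p a q b c e hpq hs ha he1 hle ih =>
    have hdom {f : A} (hf : L.Edge (wit p a q b c) f (wit p a q b c)) : e ≤ W.comp f e :=
      W.domain_of_le_comp hf.le_one'_of_self hf.domain_wit hle
    rw [(W.subidentity_le_comp_self hatomic ha he1).2]
    exact ⟨fun _ => hdom, fun _ => hdom⟩
  | left hpq hs ih =>
    exact ⟨fun e he => W.domain_of_le_comp he.le_one'_of_self (ih.1 e he)
      (W.cycle_left hpq.isAtom hs.left_atom hs.le), fun e he => he.domain_wit⟩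
  | left_conv hpq hs ih =>
    rw [W.conv_conv]
    exact ⟨fun e he => he.domain_wit,
      fun e he => W.domain_of_le_comp he.le_one'_of_self (ih.1 e he)
        (W.cycle_left hpq.isAtom hs.left_atom hs.le)⟩
  | right hpq hs ih =>
    exact ⟨fun e he => wit_right hpq hs he,
      fun e he => W.domain_of_le_comp he.le_one'_of_self (ih.2 e he)
        (W.cycle_left (W.isAtom_conv hpq.isAtom) (W.isAtom_conv hs.right_atom)
          (W.conv_le_comp hs.le))⟩
  | right_conv hpq hs ih =>
    rw [W.conv_conv]
    exact ⟨fun e he => W.domain_of_le_comp he.le_one'_of_self (ih.2 e he)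
        (W.cycle_left (W.isAtom_conv hpq.isAtom) (W.isAtom_conv hs.right_atom)
          (W.conv_le_comp hs.le)),
      fun e he => wit_right hpq hs he⟩

theorem exists_self (hatomic : ∀ x : A, x ≠ ⊥ → ∃ a : A, IsAtom a ∧ a ≤ x)
    {x y : Point A U} {s : A} (h : L.Edge x s y) :
    (∃ e, L.Edge x e x) ∧ ∃ e, L.Edge y e y := by
  have base_case : ∀ u : U, ∃ e, L.Edge (Point.base u) e (Point.base u) := fun u =>
    let ⟨e, _, _, he⟩ := (L.ident_iff u u).mp rfl
    ⟨e, .base he⟩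
  have wit_case : ∀ {p q : Point A U} {a b c : A}, L.Edge p a q → Splits W a b c →
      ∃ e, L.Edge (wit p a q b c) e (wit p a q b c) := by
    intro p q a b c hpq hs
    obtain ⟨e, he, he1, hle⟩ := W.exists_domain hatomic (W.isAtom_conv hs.left_atom)
    rw [W.conv_conv] at hle
    exact ⟨e, .loop hpq hs he he1 hle⟩
  induction h with
  | base h => exact ⟨base_case _, base_case _⟩
  | loop hpq hs => exact ⟨wit_case hpq hs, wit_case hpq hs⟩
  | left hpq hs ih => exact ⟨ih.1, wit_case hpq hs⟩
  | left_conv hpq hs ih => exact ⟨wit_case hpq hs, ih.1⟩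
  | right hpq hs ih => exact ⟨wit_case hpq hs, ih.2⟩
  | right_conv hpq hs ih => exact ⟨ih.2, wit_case hpq hs⟩

end Edge

theorem Child.functional {x w : Point A U} {s t : A} (hs : L.Child x s w)
    (ht : L.Child x t w) : s = t := by
  have degenerate : ∀ {p : Point A U} {a b c : A}, L.Edge p a p → Splits W a b c →
      b = W.conv c := by
    intro p a b c h hsp
    have h1 := (W.cycle_left h.isAtom hsp.left_atom hsp.le).trans
      (W.comp_mono_left _ h.le_one'_of_self)
    rw [W.one'_comp] at h1
    exact ((W.isAtom_conv hsp.right_atom).le_iff_eq hsp.left_atom.1).mp h1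
  obtain ⟨p, a, q, b, c, rfl, hpq, hsp, hs⟩ := hs
  obtain ⟨p', a', q', b', c', heq, -, -, ht⟩ := ht
  cases heq
  rcases hs with ⟨rfl, rfl⟩ | ⟨rfl, rfl⟩ <;> rcases ht with ⟨h, rfl⟩ | ⟨h, rfl⟩
  · rfl
  · subst h
    exact degenerate hpq hsp
  · subst h
    exact (degenerate hpq hsp).symm
  · rfl

namespace Edge

theorem functional (hatomic : ∀ x : A, x ≠ ⊥ → ∃ a : A, IsAtom a ∧ a ≤ x)
    {x y : Point A U} {s t : A} (hs : L.Edge x s y) (ht : L.Edge x t y) : s = t := by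
  by_cases hxy : x = y
  · subst hxy
    exact W.domain_unique hs.isAtom ht.isAtom hs.isAtom hs.le_one'_of_self
      ht.le_one'_of_self (W.subidentity_le_comp_self hatomic hs.isAtom hs.le_one'_of_self).1
      ((hs.domain_and_range hatomic).1 t ht)
  · rcases hs.classify with ⟨u, v, rfl, rfl, h⟩ | ⟨h, -⟩ | h | h
    · cases ht with
      | base h' => exact L.functional h h'
    · exact absurd h hxy
    · rcases ht.classify with ⟨u, v, rfl, rfl, -⟩ | ⟨h', -⟩ | h' | h'
      · obtain ⟨_, _, _, _, _, h, -⟩ := h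
        cases h
      · exact absurd h' hxy
      · exact h.functional h'
      · exact absurd h.depth_lt h'.depth_lt.asymm
    · rcases ht.classify with ⟨u, v, rfl, rfl, -⟩ | ⟨h', -⟩ | h' | h'
      · obtain ⟨_, _, _, _, _, h, -⟩ := h
        cases h
      · exact absurd h' hxy
      · exact absurd h.depth_lt h'.depth_lt.asymm
      · rw [← W.conv_conv s, h.functional h', W.conv_conv]

end Edge

variable (L) in
/-- Every triangle of edges on the points `x`, `y`, `z` is consistent. -/
def Consistent (x y z : Point A U) : Prop :=
  ∀ ⦃r s t⦄, L.Edge x s y → L.Edge y t z → L.Edge x r z → r ≤ W.comp s t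

theorem Consistent.swap (hatomic : ∀ x : A, x ≠ ⊥ → ∃ a : A, IsAtom a ∧ a ≤ x)
    {x y z : Point A U} (h : L.Consistent x y z) : L.Consistent y x z := by
  intro r s t hs ht hr
  simpa [W.conv_conv] using
    W.cycle_right ht.isAtom hr.isAtom (h (hs.conv hatomic) hr ht)

theorem Consistent.reverse (hatomic : ∀ x : A, x ≠ ⊥ → ∃ a : A, IsAtom a ∧ a ≤ x)
    {x y z : Point A U} (h : L.Consistent x y z) : L.Consistent z y x := by
  intro r s t hs ht hr
  simpa [W.conv_conv] using
    W.conv_le_comp (h (ht.conv hatomic) (hs.conv hatomic) (hr.conv hatomic))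

theorem consistent_self (hatomic : ∀ x : A, x ≠ ⊥ → ∃ a : A, IsAtom a ∧ a ≤ x)
    (x y : Point A U) : L.Consistent x x y := by
  intro r s t hs ht hr
  obtain rfl := hr.functional hatomic ht
  exact (hr.domain_and_range hatomic).1 s hs

theorem consistent_of_children (hatomic : ∀ x : A, x ≠ ⊥ → ∃ a : A, IsAtom a ∧ a ≤ x)
    {x y w : Point A U} {s t : A} (hxy : x ≠ y) (hx : L.Child x s w) (hy : L.Child y t w) :
    L.Consistent x w y := by
  obtain ⟨p, a, q, b, c, rfl, hpq, hsp, hx⟩ := hx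
  obtain ⟨p', a', q', b', c', heq, -, -, hy⟩ := hy
  cases heq
  have key : L.Consistent p (wit p a q b c) q := by
    intro r s t hs ht hr
    obtain rfl := hs.functional hatomic (.left hpq hsp)
    obtain rfl := ht.functional hatomic (.right hpq hsp)
    obtain rfl := hr.functional hatomic hpq
    exact hsp.le
  rcases hx with ⟨rfl, -⟩ | ⟨rfl, -⟩ <;> rcases hy with ⟨rfl, -⟩ | ⟨rfl, -⟩
  · exact absurd rfl hxy
  · exact key
  · exact key.reverse hatomic
  · exact absurd rfl hxy

theorem Edge.adjacent {x y : Point A U} {s : A} (h : L.Edge x s y) (hxy : x ≠ y) :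
    (x.depth = 0 ∧ y.depth = 0) ∨ (x.depth < y.depth ∧ ∃ r, L.Child x r y) ∨
      (y.depth < x.depth ∧ ∃ r, L.Child y r x) := by
  rcases h.classify with ⟨u, v, rfl, rfl, -⟩ | ⟨h, -⟩ | h | h
  · exact .inl ⟨rfl, rfl⟩
  · exact absurd h hxy
  · exact .inr (.inl ⟨h.depth_lt, _, h⟩)
  · exact .inr (.inr ⟨h.depth_lt, _, h⟩)

theorem consistent (hatomic : ∀ x : A, x ≠ ⊥ → ∃ a : A, IsAtom a ∧ a ≤ x)
    (x y z : Point A U) : L.Consistent x y z := by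
  by_cases hxy : x = y
  · subst hxy
    exact consistent_self hatomic _ _
  by_cases hyz : y = z
  · subst hyz
    exact (consistent_self hatomic _ _).reverse hatomic
  by_cases hxz : x = z
  · subst hxz
    exact ((consistent_self hatomic _ _).reverse hatomic).swap hatomic
  intro r s t hs ht hr
  by_cases hbase : x.depth = 0 ∧ y.depth = 0 ∧ z.depth = 0
  · cases hs with
    | base hs =>
      cases ht with
      | base ht =>
        cases hr with
        | base hr => exact L.triangle hs ht hr
      | _ => simp [Point.depth] at hbase
    | _ => simp [Point.depth] at hbase
  have apex : (∃ s t, L.Child x s y ∧ L.Child z t y) ∨ (∃ s t, L.Child y s x ∧ L.Child z t x) ∨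
      ∃ s t, L.Child x s z ∧ L.Child y t z := by
    rcases hs.adjacent hxy with h1 | ⟨h1, s1, c1⟩ | ⟨h1, s1, c1⟩ <;>
    rcases ht.adjacent hyz with h2 | ⟨h2, s2, c2⟩ | ⟨h2, s2, c2⟩ <;>
    rcases hr.adjacent hxz with h3 | ⟨h3, s3, c3⟩ | ⟨h3, s3, c3⟩ <;>
    first
    | omega
    | exact .inl ⟨_, _, c1, c2⟩
    | exact .inr (.inl ⟨_, _, c1, c3⟩)
    | exact .inr (.inr ⟨_, _, c3, c2⟩)
  rcases apex with ⟨_, _, h1, h2⟩ | ⟨_, _, h1, h2⟩ | ⟨_, _, h1, h2⟩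
  · exact consistent_of_children hatomic hxz h1 h2 hs ht hr
  · exact (consistent_of_children hatomic hyz h1 h2).swap hatomic hs ht hr
  · exact (((consistent_of_children hatomic hxy h1 h2).reverse hatomic).swap hatomic).reverse
      hatomic hs ht hr

variable (L) in
/-- The free completion of a labelling system over an atomic algebra. -/
def completion (hatomic : ∀ x : A, x ≠ ⊥ → ∃ a : A, IsAtom a ∧ a ≤ x) :
    LabSys W {x : Point A U // ∃ e, L.Edge x e x} where
  T := {t | L.Edge t.1 t.2.1 t.2.2}
  mem_atom _ _ _ h := Edge.isAtom h
  functional _ _ _ _ h h' := Edge.functional hatomic h h'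
  ident_exists a ha ha1 :=
    let ⟨u, hu⟩ := L.ident_exists a ha ha1
    ⟨⟨.base u, a, .base hu⟩, .base hu⟩
  ident_iff x y := by
    constructor
    · rintro rfl
      obtain ⟨x, e, he⟩ := x
      exact ⟨e, he.isAtom, he.le_one'_of_self, he⟩
    · rintro ⟨a, -, ha1, h⟩
      exact Subtype.ext (Edge.eq_of_le_one' h ha1)
  conv_mem _ _ _ h := Edge.conv hatomic h
  triangle _ _ _ _ _ _ hs ht hr := consistent hatomic _ _ _ hs ht hr

theorem Edge.exists_witness (hatomic : ∀ x : A, x ≠ ⊥ → ∃ a : A, IsAtom a ∧ a ≤ x)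
    {x y : Point A U} {a b c : A} (h : L.Edge x a y) (hb : IsAtom b) (hc : IsAtom c)
    (hle : a ≤ W.comp b c) : ∃ w, L.Edge x b w ∧ L.Edge w c y := by
  by_cases hb1 : b ≤ W.one'
  · obtain rfl : a = c := (hc.le_iff_eq h.isAtom.1).mp (by
      simpa [W.one'_comp] using hle.trans (W.comp_mono_left c hb1))
    obtain ⟨e, he⟩ := (h.exists_self hatomic).1
    obtain rfl := W.domain_unique he.isAtom hb hc he.le_one'_of_self hb1
      ((h.domain_and_range hatomic).1 e he) hle
    exact ⟨x, he, h⟩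
  by_cases hc1 : c ≤ W.one'
  · obtain rfl : a = b := (hb.le_iff_eq h.isAtom.1).mp (by
      simpa [W.comp_one'] using hle.trans (W.comp_mono_right b hc1))
    obtain ⟨e, he⟩ := (h.exists_self hatomic).2
    have hle' := W.conv_le_comp hle
    rw [(W.subidentity_le_comp_self hatomic hc hc1).2] at hle'
    obtain rfl := W.domain_unique he.isAtom hc (W.isAtom_conv hb) he.le_one'_of_self hc1
      ((h.domain_and_range hatomic).2 e he) hle'
    exact ⟨y, h, he⟩
  have hs : Splits W a b c := ⟨hb, hc, hle, hb1, hc1⟩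
  exact ⟨_, .left h hs, .right h hs⟩

end LabSys

/-- Lemma C: every labelling system can be extended to a complete labelling
system, i.e. one with no flaws. -/
theorem stmt_5 {A : Type u} [BooleanAlgebra A] (W : WA A)
    (hatomic : ∀ x : A, x ≠ ⊥ → ∃ a : A, IsAtom a ∧ a ≤ x)
    {U : Type v} (L : LabSys W U) :
    ∃ (U' : Type (max u v)) (i : U ↪ U') (L' : LabSys W U'),
      (∀ (p : U) (x : A) (q : U), (p, x, q) ∈ L.T → (i p, x, i q) ∈ L'.T) ∧
      ∀ (u v : U') (a b c : A), ¬ Flaw W L' u a v b c := by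
  have hloop : ∀ u : U, ∃ e, L.Edge (.base u) e (.base u) := fun u =>
    let ⟨e, _, _, he⟩ := (L.ident_iff u u).mp rfl
    ⟨e, .base he⟩
  refine ⟨_, ⟨fun u => ⟨.base u, hloop u⟩, fun u v h => ?_⟩, L.completion hatomic, ?_, ?_⟩
  · simpa using h
  · exact fun p x q h => LabSys.Edge.base h
  · rintro u v a b c ⟨-, hb, hc, h, hle, hflaw⟩
    obtain ⟨w, h1, h2⟩ := LabSys.Edge.exists_witness hatomic h hb hc hle
    rcases hflaw ⟨w, (LabSys.Edge.exists_self hatomic h1).2⟩ with h' | h'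
    · exact h' h1
    · exact h' h2
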